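/- Let R be a tolerance on a set U, S = {x ∈ U | R(x) = {x}}, and 𝕂 = (U, U, Rᶜ). Define the disjoint representation D(RS) = {(A, B) ∈ ℘(U)^▽ × ℘(U)^▽ | A^△ ∩ B^△ = ∅ and S ⊆ A ∪ B}, ordered by the order of ℘(U)^▽ × (℘(U)^▽)^op, and the formal concept representation FC(RS) = {(α, β) ∈ 𝔅(𝕂) × 𝔅(𝕂) | β ≤ α^∇ in 𝔅(𝕂) and S ⊆ ext(α) ∪ ext(β)}, ordered by the order of 𝔅(𝕂) × 𝔅(𝕂)^op. Then: (a) FC(RS) is a complete sublattice of 𝔅(𝕂) × 𝔅(𝕂)^op; (b) FC(RS) and D(RS) are order-isomorphic complete lattices, via the map (A, B) ↦ ((A, A^⊤), (B, B^⊤)) where A^⊤ = A^{c▽}. -/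

import Mathlib

open Set

universe u v

def Tolerance {U : Type*} (R : U → U → Prop) : Prop := Reflexive R ∧ Symmetric R

def tolNbhd {U : Type*} (R : U → U → Prop) (x : U) : Set U := {y | R x y}

def lowerApprox {U : Type*} (R : U → U → Prop) (X : Set U) : Set U :=
  {x | tolNbhd R x ⊆ X}

def upperApprox {U : Type*} (R : U → U → Prop) (X : Set U) : Set U :=
  {x | (tolNbhd R x ∩ X).Nonempty}

def RSpairs {U : Type*} (R : U → U → Prop) : Set (Set U × Set U) :=
  {p | ∃ X : Set U, p = (lowerApprox R X, upperApprox R X)}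

def IsPreblock {U : Type*} (R : U → U → Prop) (B : Set U) : Prop :=
  ∀ x ∈ B, ∀ y ∈ B, R x y

def IsBlock {U : Type*} (R : U → U → Prop) (B : Set U) : Prop :=
  IsPreblock R B ∧ ∀ C : Set U, IsPreblock R C → B ⊆ C → B = C

def IsCovering {U : Type*} (H : Set (Set U)) : Prop :=
  (∀ X ∈ H, X.Nonempty) ∧ ⋃₀ H = Set.univ

def IsIrredundantCovering {U : Type*} (H : Set (Set U)) : Prop :=
  IsCovering H ∧ ∀ X ∈ H, ¬ IsCovering (H \ {X})

def InducedBy {U : Type*} (R : U → U → Prop) (H : Set (Set U)) : Prop :=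
  ∀ x y : U, R x y ↔ ∃ B ∈ H, x ∈ B ∧ y ∈ B

def singl {U : Type*} (R : U → U → Prop) : Set U := {x | tolNbhd R x = {x}}

def pol {U : Type*} (R : U → U → Prop) (A : Set U) : Set U := {y | ∀ x ∈ A, ¬ R x y}

def Concepts {U : Type*} (R : U → U → Prop) : Set (Set U × (Set U)ᵒᵈ) :=
  {p | pol R p.1 = OrderDual.ofDual p.2 ∧ pol R (OrderDual.ofDual p.2) = p.1}

def restrictRel {U : Type*} (R : U → U → Prop) (X : Set U) : ↥X → ↥X → Prop :=
  fun a b => R a b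

def CondC {U : Type*} (R : U → U → Prop) : Prop :=
  ∀ a : Fin 5 → U, Function.Injective a →
    (∀ i : Fin 4, R (a i.castSucc) (a i.succ)) →
    ∃ i j : Fin 5, ((i : ℕ) + 2 ≤ (j : ℕ) ∨ (j : ℕ) + 2 ≤ (i : ℕ)) ∧ R (a i) (a j)

/-- The extent of a formal concept of the context `(U, U, Rᶜ)`. -/
def cExt {U : Type*} {R : U → U → Prop} (c : ↥(Concepts R)) : Set U :=
  (c : Set U × (Set U)ᵒᵈ).1

/-- The intent of a formal concept of the context `(U, U, Rᶜ)`. -/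
def cInt {U : Type*} {R : U → U → Prop} (c : ↥(Concepts R)) : Set U :=
  OrderDual.ofDual (c : Set U × (Set U)ᵒᵈ).2

/-- The disjoint representation of rough sets, as a subset of `℘(U)^▽ × (℘(U)^▽)ᵒᵖ`. -/
def DRS {U : Type*} (R : U → U → Prop) : Set (Set U × (Set U)ᵒᵈ) :=
  {p | p.1 ∈ Set.range (lowerApprox R) ∧
       OrderDual.ofDual p.2 ∈ Set.range (lowerApprox R) ∧
       upperApprox R p.1 ∩ upperApprox R (OrderDual.ofDual p.2) = ∅ ∧
       singl R ⊆ p.1 ∪ OrderDual.ofDual p.2}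

/-- The formal concept representation of rough sets, as a subset of `𝔅(𝕂) × 𝔅(𝕂)ᵒᵖ`.
The condition `β ≤ α^∇` is expressed via extents: `ext β ⊆ ((int α)ᶜ)' = pol R ((int α)ᶜ)`. -/
def FCRS {U : Type*} (R : U → U → Prop) : Set (↥(Concepts R) × (↥(Concepts R))ᵒᵈ) :=
  {q | cExt (OrderDual.ofDual q.2) ⊆ pol R ((cInt q.1)ᶜ) ∧
       singl R ⊆ cExt q.1 ∪ cExt (OrderDual.ofDual q.2)}

theorem mem_pol_aux {U : Type*} {R : U → U → Prop} {A : Set U} {y : U} :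
    y ∈ pol R A ↔ ∀ x ∈ A, ¬ R x y := Iff.rfl

theorem pol_pol_pol_aux {U : Type*} {R : U → U → Prop} (hs : ∀ x y, R x y → R y x) (A : Set U) :
    pol R (pol R (pol R A)) = pol R A := by
  ext y
  simp only [mem_pol_aux]
  constructor
  · intro h x hx
    exact h x (fun z hz hzx => hz x hx (hs _ _ hzx))
  · intro h x hx hxy
    exact hx y h (hs _ _ hxy)

theorem lower_eq_pol_aux {U : Type*} {R : U → U → Prop} (hs : ∀ x y, R x y → R y x) (X : Set U) :
    lowerApprox R X = pol R Xᶜ := by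
  ext y
  constructor
  · intro h x hx hxy
    exact hx (h (hs _ _ hxy))
  · intro h x hx
    by_contra hc
    exact h x hc (hs _ _ hx)

/-- The concept with extent `pol X`. -/
def extC {U : Type*} {R : U → U → Prop} (hs : ∀ x y, R x y → R y x) (X : Set U) :
    ↥(Concepts R) :=
  ⟨(pol R X, OrderDual.toDual (pol R (pol R X))), rfl, pol_pol_pol_aux hs X⟩

/-- The concept with intent `pol X`. -/
def intC {U : Type*} {R : U → U → Prop} (hs : ∀ x y, R x y → R y x) (X : Set U) :
    ↥(Concepts R) :=
  ⟨(pol R (pol R X), OrderDual.toDual (pol R X)), pol_pol_pol_aux hs X, rfl⟩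

theorem pol_ext_aux {U : Type*} {R : U → U → Prop} (c : ↥(Concepts R)) :
    pol R (cExt c) = cInt c := c.2.1

theorem pol_int_aux {U : Type*} {R : U → U → Prop} (c : ↥(Concepts R)) :
    pol R (cInt c) = cExt c := c.2.2

theorem pol_anti_aux {U : Type*} {R : U → U → Prop} {A B : Set U} (h : A ⊆ B) :
    pol R B ⊆ pol R A := fun _ hy x hx => hy x (h hx)

theorem le_iff_ext {U : Type*} {R : U → U → Prop} (c d : ↥(Concepts R)) :
    c ≤ d ↔ cExt c ⊆ cExt d := by
  constructor
  · intro h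
    exact h.1
  · intro h
    refine ⟨h, ?_⟩
    change cInt d ⊆ cInt c
    rw [← pol_ext_aux, ← pol_ext_aux]
    exact pol_anti_aux h

theorem le_iff_int {U : Type*} {R : U → U → Prop} (c d : ↥(Concepts R)) :
    c ≤ d ↔ cInt d ⊆ cInt c := by
  constructor
  · intro h
    exact h.2
  · intro h
    rw [le_iff_ext, ← pol_int_aux, ← pol_int_aux]
    exact pol_anti_aux h

/-- Disjointness condition on extents. -/
def Disj {U : Type*} (R : U → U → Prop) (A B : Set U) : Prop :=
  ∀ a ∈ A, ∀ b ∈ B, ∀ x, R x a → R x b → False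

theorem disj_symm {U : Type*} {R : U → U → Prop} {A B : Set U} (h : Disj R A B) : Disj R B A :=
  fun b hb a ha x h1 h2 => h a ha b hb x h2 h1

theorem sub_iff_disj {U : Type*} {R : U → U → Prop} (hs : ∀ x y, R x y → R y x)
    (c : ↥(Concepts R)) (B : Set U) :
    B ⊆ pol R (cInt c)ᶜ ↔ Disj R (cExt c) B := by
  rw [← pol_ext_aux]
  constructor
  · intro h a ha b hb x h1 h2
    exact h hb x (fun hx => hx a ha (hs _ _ h1)) h2
  · intro h y hy x hx hxy
    apply hx
    intro a ha hax
    exact h a ha y hy x (hs _ _ hax) hxy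

theorem upper_iff_disj {U : Type*} {R : U → U → Prop} (A B : Set U) :
    upperApprox R A ∩ upperApprox R B = ∅ ↔ Disj R A B := by
  rw [Set.eq_empty_iff_forall_notMem]
  constructor
  · intro h a ha b hb x h1 h2
    exact h x ⟨⟨a, h1, ha⟩, ⟨b, h2, hb⟩⟩
  · rintro h x ⟨⟨a, h1, ha⟩, ⟨b, h2, hb⟩⟩
    exact h a ha b hb x h1 h2

section
variable {U : Type*} {R : U → U → Prop} (hs : ∀ x y, R x y → R y x) {ι : Type*}
  (c d : ι → ↥(Concepts R))

/-- meet -/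
def meetC : ↥(Concepts R) := extC hs (⋃ i, cInt (c i))
/-- join -/
def joinC : ↥(Concepts R) := intC hs (⋃ i, cExt (c i))

theorem ext_meetC : cExt (meetC hs c) = ⋂ i, cExt (c i) := by
  change pol R _ = _
  ext y
  simp only [← pol_int_aux, mem_pol_aux, Set.mem_iUnion, Set.mem_iInter]
  constructor
  · intro h i x hx
    exact h x ⟨i, hx⟩
  · rintro h x ⟨i, hx⟩
    exact h i x hx

theorem int_joinC : cInt (joinC hs c) = ⋂ i, cInt (c i) := by
  change pol R _ = _
  ext y
  simp only [← pol_ext_aux, mem_pol_aux, Set.mem_iUnion, Set.mem_iInter]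
  constructor
  · intro h i x hx
    exact h x ⟨i, hx⟩
  · rintro h x ⟨i, hx⟩
    exact h i x hx

theorem le_meetC (e : ↥(Concepts R)) : e ≤ meetC hs c ↔ ∀ i, e ≤ c i := by
  simp only [le_iff_ext, ext_meetC, Set.subset_iInter_iff]

theorem joinC_le (e : ↥(Concepts R)) : joinC hs c ≤ e ↔ ∀ i, c i ≤ e := by
  simp only [le_iff_int, int_joinC, Set.subset_iInter_iff]

theorem disj_join (h : ∀ i, Disj R (cExt (c i)) (cExt (d i))) :
    Disj R (cExt (joinC hs c)) (cExt (meetC hs d)) := by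
  rw [← sub_iff_disj hs, int_joinC, ext_meetC]
  intro y hy x hx
  rw [Set.mem_compl_iff, Set.mem_iInter, not_forall] at hx
  obtain ⟨i, hi⟩ := hx
  exact (sub_iff_disj hs (c i) _).2 (h i) (Set.mem_iInter.1 hy i) x hi

theorem sing_join (S : Set U) (h : ∀ i, S ⊆ cExt (c i) ∪ cExt (d i)) :
    S ⊆ cExt (joinC hs c) ∪ cExt (meetC hs d) := by
  intro s hS
  by_cases hh : ∃ i, s ∈ cExt (c i)
  · obtain ⟨i, hi⟩ := hh
    exact Or.inl ((le_iff_ext _ _).1 ((joinC_le hs c _).1 le_rfl i) hi)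
  · right
    rw [ext_meetC, Set.mem_iInter]
    intro i
    exact (h i hS).resolve_left (fun h1 => hh ⟨i, h1⟩)
end

theorem mem_FCRS_iff {U : Type*} {R : U → U → Prop} (hs : ∀ x y, R x y → R y x)
    (q : ↥(Concepts R) × (↥(Concepts R))ᵒᵈ) :
    q ∈ FCRS R ↔ Disj R (cExt q.1) (cExt (OrderDual.ofDual q.2)) ∧
      singl R ⊆ cExt q.1 ∪ cExt (OrderDual.ofDual q.2) := by
  rw [← sub_iff_disj hs]
  rfl

theorem concept_ext {U : Type*} {R : U → U → Prop} {c d : ↥(Concepts R)}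
    (h : cExt c = cExt d) : c = d :=
  le_antisymm ((le_iff_ext _ _).2 h.subset) ((le_iff_ext _ _).2 h.symm.subset)

theorem lower_extC {U : Type*} {R : U → U → Prop} (hs : ∀ x y, R x y → R y x) {A : Set U}
    (h : A ∈ Set.range (lowerApprox R)) : cExt (intC hs A) = A := by
  obtain ⟨X, rfl⟩ := h
  rw [lower_eq_pol_aux hs]
  exact pol_pol_pol_aux hs _

theorem ext_mem_range {U : Type*} {R : U → U → Prop} (hs : ∀ x y, R x y → R y x)
    (c : ↥(Concepts R)) : cExt c ∈ Set.range (lowerApprox R) :=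
  ⟨(cInt c)ᶜ, by rw [lower_eq_pol_aux hs, compl_compl, pol_int_aux]⟩

/-- The isomorphism. -/
def theIso {U : Type*} {R : U → U → Prop} (hs : ∀ x y, R x y → R y x) :
    ↥(DRS R) ≃o ↥(FCRS R) where
  toFun p := ⟨(intC hs p.1.1, OrderDual.toDual (intC hs (OrderDual.ofDual p.1.2))), by
    obtain ⟨p, h1, h2, h3, h4⟩ := p
    rw [mem_FCRS_iff hs]
    simp only [OrderDual.ofDual_toDual, lower_extC hs h1, lower_extC hs h2]
    exact ⟨(upper_iff_disj _ _).1 h3, h4⟩⟩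
  invFun q := ⟨(cExt q.1.1, OrderDual.toDual (cExt (OrderDual.ofDual q.1.2))), by
    obtain ⟨q, hq⟩ := q
    rw [mem_FCRS_iff hs] at hq
    exact ⟨ext_mem_range hs _, ext_mem_range hs _, (upper_iff_disj _ _).2 hq.1, hq.2⟩⟩
  left_inv p := by
    obtain ⟨p, h1, h2, h3, h4⟩ := p
    apply Subtype.ext
    exact Prod.ext (lower_extC hs h1) (lower_extC hs h2)
  right_inv q := by
    apply Subtype.ext
    exact Prod.ext (concept_ext (lower_extC hs (ext_mem_range hs _)))
      (concept_ext (lower_extC hs (ext_mem_range hs _)))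
  map_rel_iff' := by
    rintro ⟨p, h1, h2, h3, h4⟩ ⟨q, k1, k2, k3, k4⟩
    change (intC hs p.1 ≤ intC hs q.1 ∧
      intC hs (OrderDual.ofDual q.2) ≤ intC hs (OrderDual.ofDual p.2)) ↔
      (p.1 ⊆ q.1 ∧ OrderDual.ofDual q.2 ⊆ OrderDual.ofDual p.2)
    rw [le_iff_ext, le_iff_ext, lower_extC hs h1, lower_extC hs h2, lower_extC hs k1,
      lower_extC hs k2]

theorem stmt_19 {U : Type u} (R : U → U → Prop) (hR : Tolerance R) :
    -- (a) FC(RS) is a complete sublattice of 𝔅(𝕂) × 𝔅(𝕂)ᵒᵖ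
    (∀ (ι : Type u) (f : ι → ↥(Concepts R) × (↥(Concepts R))ᵒᵈ), (∀ i, f i ∈ FCRS R) →
      (∃ p ∈ FCRS R, IsLUB (Set.range f) p) ∧ (∃ p ∈ FCRS R, IsGLB (Set.range f) p)) ∧
    -- (b) FC(RS) ≃o D(RS) via (A, B) ↦ ((A, A^⊤), (B, B^⊤)), where A^⊤ = (Aᶜ)^▽
    (∃ e : ↥(DRS R) ≃o ↥(FCRS R), ∀ p : ↥(DRS R),
      cExt ((e p : ↥(Concepts R) × (↥(Concepts R))ᵒᵈ).1) = (p : Set U × (Set U)ᵒᵈ).1 ∧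
      cInt ((e p : ↥(Concepts R) × (↥(Concepts R))ᵒᵈ).1) =
        lowerApprox R (((p : Set U × (Set U)ᵒᵈ).1)ᶜ) ∧
      cExt (OrderDual.ofDual (e p : ↥(Concepts R) × (↥(Concepts R))ᵒᵈ).2) =
        OrderDual.ofDual (p : Set U × (Set U)ᵒᵈ).2 ∧
      cInt (OrderDual.ofDual (e p : ↥(Concepts R) × (↥(Concepts R))ᵒᵈ).2) =
        lowerApprox R ((OrderDual.ofDual (p : Set U × (Set U)ᵒᵈ).2)ᶜ)) := by
  have hs : ∀ x y, R x y → R y x := fun x y h => hR.2 h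
  refine ⟨?_, theIso hs, ?_⟩
  · intro ι f hf
    simp only [mem_FCRS_iff hs] at hf
    let c : ι → ↥(Concepts R) := fun i => (f i).1
    let d : ι → ↥(Concepts R) := fun i => OrderDual.ofDual (f i).2
    constructor
    · refine ⟨(joinC hs c, OrderDual.toDual (meetC hs d)), ?_, ?_⟩
      · rw [mem_FCRS_iff hs]
        exact ⟨disj_join hs c d fun i => (hf i).1, sing_join hs c d _ fun i => (hf i).2⟩
      · rw [isLUB_iff_le_iff]
        intro b
        rw [mem_upperBounds, Set.forall_mem_range]
        constructor
        · intro h i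
          exact ⟨(joinC_le hs c _).1 h.1 i, (le_meetC hs d (OrderDual.ofDual b.2)).1 h.2 i⟩
        · intro h
          exact ⟨(joinC_le hs c _).2 fun i => (h i).1,
            (le_meetC hs d (OrderDual.ofDual b.2)).2 fun i => (h i).2⟩
    · refine ⟨(meetC hs c, OrderDual.toDual (joinC hs d)), ?_, ?_⟩
      · rw [mem_FCRS_iff hs]
        refine ⟨disj_symm (disj_join hs d c fun i => disj_symm (hf i).1), ?_⟩
        rw [Set.union_comm]
        exact sing_join hs d c _ fun i => by
          rw [Set.union_comm]
          exact (hf i).2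
      · rw [isGLB_iff_le_iff]
        intro b
        rw [mem_lowerBounds, Set.forall_mem_range]
        constructor
        · intro h i
          exact ⟨(le_meetC hs c _).1 h.1 i, (joinC_le hs d (OrderDual.ofDual b.2)).1 h.2 i⟩
        · intro h
          exact ⟨(le_meetC hs c _).2 fun i => (h i).1,
            (joinC_le hs d (OrderDual.ofDual b.2)).2 fun i => (h i).2⟩
  · rintro ⟨p, h1, h2, h3, h4⟩
    rw [lower_eq_pol_aux hs, lower_eq_pol_aux hs, compl_compl, compl_compl]
    exact ⟨lower_extC hs h1, rfl, lower_extC hs h2, rfl⟩
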